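/- arXiv:1708.06443 — 5 statements merged into one kernel-verified Lean document; each statement's English description precedes it below -/
import Mathlib

section
/- In the canonical two-stage model, fix x* = (x_z, x_r) ∈ ℝ^ℓ × ℝ^s with x_z ≠ 0 and x_r ≠ 0, let c: ℝ^{ℓ+s} → ℝ be a measurable scalar function with c(x*) ≠ 0, set μ̂ = c(x*)·x_z, and let β̂ be the control-function estimator computed from x* and Y* with control vector b = ((1−c(x*))x_z', x_r')' (assume (x*)'a x* ≠ 0 where a = I − b(b'b)⁻¹b'). Then E[β̂ | X* = x*] − β = (μ̂'(μ̂ − μ)/(μ̂'μ̂))·(ρσ/τ) = (1 − (1/c(x*))·(x_z'μ)/(x_z'x_z))·(ρσ/τ). -/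
open MeasureTheory ProbabilityTheory Matrix

/-- Conditional law of `Y*` given `X* = x` in the canonical two-stage model:
independent coordinates with `Y*_i ~ N(x_i β + (x_i − μ₀_i)(ρσ/τ), (1−ρ²)σ²)`,
where `μ₀ = (μ', 0'_s)'`. -/
noncomputable def lawYgiven (ℓ s : ℕ) (μ : Fin ℓ → ℝ) (β ρ σ τ : ℝ)
    (x : Fin ℓ ⊕ Fin s → ℝ) : Measure (Fin ℓ ⊕ Fin s → ℝ) :=
  Measure.pi fun i =>
    gaussianReal (x i * β + (x i - Sum.elim μ (0 : Fin s → ℝ) i) * (ρ * σ / τ))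
      ((1 - ρ ^ 2) * σ ^ 2).toNNReal

/-- The annihilator matrix `a = I − b(b'b)⁻¹b'` associated with a control vector `b`. -/
noncomputable def annih {ι : Type*} [Fintype ι] [DecidableEq ι] (b : ι → ℝ) :
    Matrix ι ι ℝ :=
  1 - (b ⬝ᵥ b)⁻¹ • Matrix.vecMulVec b b

/-- The control-function estimator `β̂ = x'a y/(x'a x)` with control vector `b`. -/
noncomputable def cfEst {ι : Type*} [Fintype ι] [DecidableEq ι]
    (b x y : ι → ℝ) : ℝ :=
  (x ⬝ᵥ (annih b).mulVec y) / (x ⬝ᵥ (annih b).mulVec x)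

theorem dotProduct_annih_mulVec {ι : Type*} [Fintype ι] [DecidableEq ι] (b x y : ι → ℝ) :
    x ⬝ᵥ (annih b).mulVec y = x ⬝ᵥ y - (b ⬝ᵥ b)⁻¹ * ((x ⬝ᵥ b) * (b ⬝ᵥ y)) := by
  simp only [annih, Matrix.sub_mulVec, Matrix.one_mulVec, Matrix.smul_mulVec,
    Matrix.vecMulVec_mulVec, dotProduct_sub, dotProduct_smul, op_smul_eq_smul,
    smul_eq_mul]
  ring

theorem integral_dotProduct_pi_gaussianReal {ι : Type*} [Fintype ι] (w m : ι → ℝ)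
    (v : ι → NNReal) :
    ∫ y, w ⬝ᵥ y ∂(Measure.pi fun i => gaussianReal (m i) (v i)) = w ⬝ᵥ m := by
  have hint (i : ι) : Integrable (fun t : ℝ => t) (gaussianReal (m i) (v i)) :=
    (memLp_id_gaussianReal 1).integrable le_rfl
  simp only [dotProduct]
  have hcoord (i : ι) : Integrable (fun y : ι → ℝ => y i)
      (Measure.pi fun i => gaussianReal (m i) (v i)) :=
    integrable_comp_eval (μ := fun i => gaussianReal (m i) (v i)) (hint i)
  rw [integral_finsetSum _ fun i _ => (hcoord i).const_mul (w i)]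
  refine Finset.sum_congr rfl fun i _ => ?_
  rw [integral_const_mul,
    integral_comp_eval (μ := fun i => gaussianReal (m i) (v i)) (f := fun t : ℝ => t)
      (hint i).aestronglyMeasurable, integral_id_gaussianReal]

theorem integral_cfEst_pi_gaussianReal {ι : Type*} [Fintype ι] [DecidableEq ι]
    (b x m : ι → ℝ) (v : ι → NNReal) :
    ∫ y, cfEst b x y ∂(Measure.pi fun i => gaussianReal (m i) (v i)) = cfEst b x m := by
  simp only [cfEst, integral_div, Matrix.dotProduct_mulVec, integral_dotProduct_pi_gaussianReal]

/-- conditional bias of CF–shrinkage estimators. In the canonical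
two-stage model, fix `x* = (x_z, x_r)` with `x_z ≠ 0`, `x_r ≠ 0`, a measurable scalar
function `c` with `c(x*) ≠ 0`, `μ̂ = c(x*) x_z`, and let `β̂` be the control-function
estimator with control vector `b = ((1 − c(x*))x_z', x_r')'` (assuming `x*'a x* ≠ 0`).
Then `E[β̂ | X* = x*] − β = (μ̂'(μ̂ − μ)/(μ̂'μ̂))(ρσ/τ)
= (1 − (1/c(x*))·(x_z'μ)/(x_z'x_z))(ρσ/τ)`, the conditional expectation being the
integral against the explicit conditional Gaussian law of `Y*` given `X* = x*`. -/
theorem cf_shrinkage_conditional_bias (ℓ s : ℕ) (hℓ : 1 ≤ ℓ) (hs : 1 ≤ s)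
    (μ : Fin ℓ → ℝ) (β ρ σ τ : ℝ)
    (hρ₁ : -1 < ρ) (hρ₂ : ρ < 1) (hσ : 0 < σ) (hτ : 0 < τ)
    (xz : Fin ℓ → ℝ) (xr : Fin s → ℝ) (hxz : xz ≠ 0) (hxr : xr ≠ 0)
    (x : Fin ℓ ⊕ Fin s → ℝ) (hx : x = Sum.elim xz xr)
    (c : (Fin ℓ ⊕ Fin s → ℝ) → ℝ) (hc : Measurable c) (hcx : c x ≠ 0)
    (μhat : Fin ℓ → ℝ) (hμhat : μhat = c x • xz)
    (b : Fin ℓ ⊕ Fin s → ℝ) (hb : b = Sum.elim ((1 - c x) • xz) xr)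
    (hax : x ⬝ᵥ (annih b).mulVec x ≠ 0) :
    (∫ y, cfEst b x y ∂(lawYgiven ℓ s μ β ρ σ τ x)) - β
        = (μhat ⬝ᵥ (μhat - μ)) / (μhat ⬝ᵥ μhat) * (ρ * σ / τ) ∧
    (μhat ⬝ᵥ (μhat - μ)) / (μhat ⬝ᵥ μhat) * (ρ * σ / τ)
        = (1 - (1 / c x) * ((xz ⬝ᵥ μ) / (xz ⬝ᵥ xz))) * (ρ * σ / τ) := by
  have hA : xz ⬝ᵥ xz ≠ 0 := fun h => hxz (dotProduct_self_eq_zero.mp h)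
  have hR : 0 < xr ⬝ᵥ xr :=
    lt_of_le_of_ne (Finset.sum_nonneg fun i _ => mul_self_nonneg (xr i))
      fun h => hxr (dotProduct_self_eq_zero.mp h.symm)
  have hA0 : 0 ≤ xz ⬝ᵥ xz := Finset.sum_nonneg fun i _ => mul_self_nonneg (xz i)
  have hbb : (1 - c x) ^ 2 * (xz ⬝ᵥ xz) + xr ⬝ᵥ xr ≠ 0 := by positivity
  have hshrink : (μhat ⬝ᵥ (μhat - μ)) / (μhat ⬝ᵥ μhat) * (ρ * σ / τ)
      = (1 - (1 / c x) * ((xz ⬝ᵥ μ) / (xz ⬝ᵥ xz))) * (ρ * σ / τ) := by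
    simp only [hμhat, dotProduct_sub, dotProduct_smul, smul_dotProduct, smul_eq_mul]
    congr 1
    field_simp
  refine ⟨?_, hshrink⟩
  have hmean : (fun i => x i * β + (x i - Sum.elim μ (0 : Fin s → ℝ) i) * (ρ * σ / τ))
      = (β + ρ * σ / τ) • x - (ρ * σ / τ) • Sum.elim μ (0 : Fin s → ℝ) := by
    ext i
    simp only [Pi.sub_apply, Pi.smul_apply, smul_eq_mul]
    ring
  have hxax : x ⬝ᵥ (annih b).mulVec x
      = (xz ⬝ᵥ xz) * (xr ⬝ᵥ xr) * c x ^ 2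
        / ((1 - c x) ^ 2 * (xz ⬝ᵥ xz) + xr ⬝ᵥ xr) := by
    rw [dotProduct_annih_mulVec, hb]
    generalize c x = k at *
    simp only [hx, sumElim_dotProduct_sumElim, dotProduct_smul, smul_dotProduct, smul_eq_mul]
    rw [← mul_assoc (1 - k) (1 - k), ← pow_two]
    field_simp
    ring
  have hxam : x ⬝ᵥ (annih b).mulVec (Sum.elim μ (0 : Fin s → ℝ))
      = (xz ⬝ᵥ μ) * (xr ⬝ᵥ xr) * c x
        / ((1 - c x) ^ 2 * (xz ⬝ᵥ xz) + xr ⬝ᵥ xr) := by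
    rw [dotProduct_annih_mulVec, hb]
    generalize c x = k at *
    simp only [hx, sumElim_dotProduct_sumElim, dotProduct_smul, smul_dotProduct, smul_eq_mul,
      dotProduct_zero]
    rw [← mul_assoc (1 - k) (1 - k), ← pow_two]
    field_simp
    ring
  rw [hshrink, lawYgiven, integral_cfEst_pi_gaussianReal, hmean, cfEst, Matrix.mulVec_sub,
    Matrix.mulVec_smul, Matrix.mulVec_smul, dotProduct_sub, dotProduct_smul, dotProduct_smul,
    hxam, hxax]
  simp only [smul_eq_mul]
  field_simp
  ring
end

section
/- In the canonical two-stage model with ℓ ≥ 3, the bias of the two-stage least-squares estimator β̂_2SLS = (Y*_z)'X*_z/‖X*_z‖² satisfies E[β̂_2SLS] − β = (ρσ/τ)·∑_{k=0}^∞ ((ℓ−2)/(ℓ−2+2k))·κ^k e^{−κ}/k!, where κ = ‖μ‖²/(2τ²); in particular the bias has the same sign as ρ and is nonzero whenever ρ ≠ 0. -/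
open MeasureTheory ProbabilityTheory

/-- Marginal law of `X* = (X*_z, X*_r)` in the canonical two-stage model:
independent coordinates, `X*_z ~ N(μ, τ²I_ℓ)` and `X*_r ~ N(0, τ²I_s)`. -/
noncomputable def lawX (ℓ s : ℕ) (μ : Fin ℓ → ℝ) (τ : ℝ) :
    Measure (Fin ℓ ⊕ Fin s → ℝ) :=
  Measure.pi fun i => gaussianReal (Sum.elim μ (0 : Fin s → ℝ) i) (τ ^ 2).toNNReal

open Set Filter Topology
open scoped NNReal

lemma gaussianPDFReal_mul_exp_neg_mul_sq (m : ℝ) {v v' : ℝ≥0} (hv : v ≠ 0) {t : ℝ} (ht : 0 ≤ t)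
    (hv' : (v' : ℝ) = v / (1 + 2 * t * v)) (x : ℝ) :
    gaussianPDFReal m v x * Real.exp (-(t * x ^ 2)) =
      (√(1 + 2 * t * v))⁻¹ * Real.exp (-(t * m ^ 2 / (1 + 2 * t * v))) *
        gaussianPDFReal (m / (1 + 2 * t * v)) v' x := by
  have hv0 : (0 : ℝ) < v := by positivity
  have hw : 0 < 1 + 2 * t * v := by positivity
  have hsq : √(2 * Real.pi * v) = √(1 + 2 * t * v) * √(2 * Real.pi * v') := by
    rw [← Real.sqrt_mul hw.le, hv']
    congr 1
    field_simp
  have hexp : -(x - m) ^ 2 / (2 * v) + -(t * x ^ 2) = -(t * m ^ 2 / (1 + 2 * t * v)) +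
      -(x - m / (1 + 2 * t * v)) ^ 2 / (2 * v') := by
    rw [hv']
    field_simp
    ring
  rw [gaussianPDFReal, gaussianPDFReal, mul_assoc, ← Real.exp_add, hexp, Real.exp_add, hsq, mul_inv]
  ring

lemma integral_mul_exp_neg_mul_sq_gaussianReal (m : ℝ) {v v' : ℝ≥0} (hv : v ≠ 0) {t : ℝ}
    (ht : 0 ≤ t) (hv' : (v' : ℝ) = v / (1 + 2 * t * v)) (f : ℝ → ℝ) :
    ∫ x, f x * Real.exp (-(t * x ^ 2)) ∂gaussianReal m v =
      (√(1 + 2 * t * v))⁻¹ * Real.exp (-(t * m ^ 2 / (1 + 2 * t * v))) *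
        ∫ x, f x ∂gaussianReal (m / (1 + 2 * t * v)) v' := by
  have hv0 : (0 : ℝ) < v := by positivity
  have hv'0 : v' ≠ 0 := by
    have : (0 : ℝ) < v' := by rw [hv']; positivity
    exact_mod_cast this.ne'
  rw [integral_gaussianReal_eq_integral_smul hv, integral_gaussianReal_eq_integral_smul hv'0,
    ← integral_const_mul]
  refine integral_congr_ae (.of_forall fun x ↦ ?_)
  simp only [smul_eq_mul]
  rw [mul_left_comm, gaussianPDFReal_mul_exp_neg_mul_sq m hv ht hv']
  ring

lemma integral_exp_neg_mul_sq_gaussianReal (m : ℝ) {v : ℝ≥0} (hv : v ≠ 0) {t : ℝ} (ht : 0 ≤ t) :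
    ∫ x, Real.exp (-(t * x ^ 2)) ∂gaussianReal m v =
      (√(1 + 2 * t * v))⁻¹ * Real.exp (-(t * m ^ 2 / (1 + 2 * t * v))) := by
  have h := integral_mul_exp_neg_mul_sq_gaussianReal m hv ht
    (Real.coe_toNNReal (v / (1 + 2 * t * v)) (by positivity)) (fun _ ↦ 1)
  simpa using h

lemma integral_id_mul_exp_neg_mul_sq_gaussianReal (m : ℝ) {v : ℝ≥0} (hv : v ≠ 0) {t : ℝ}
    (ht : 0 ≤ t) :
    ∫ x, x * Real.exp (-(t * x ^ 2)) ∂gaussianReal m v =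
      m / (1 + 2 * t * v) *
        ((√(1 + 2 * t * v))⁻¹ * Real.exp (-(t * m ^ 2 / (1 + 2 * t * v)))) := by
  rw [integral_mul_exp_neg_mul_sq_gaussianReal m hv ht
    (Real.coe_toNNReal (v / (1 + 2 * t * v)) (by positivity)) (fun x ↦ x),
    integral_id_gaussianReal, mul_comm]

section
variable {ι : Type*} [Fintype ι]

lemma exp_neg_mul_sum_sq (t : ℝ) (x : ι → ℝ) :
    Real.exp (-(t * ∑ i, x i ^ 2)) = ∏ i, Real.exp (-(t * x i ^ 2)) := by
  rw [← Real.exp_sum, Finset.mul_sum, Finset.sum_neg_distrib]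

lemma integral_exp_neg_mul_sum_sq_pi_gaussianReal (m : ι → ℝ) {v : ℝ≥0} (hv : v ≠ 0) {t : ℝ}
    (ht : 0 ≤ t) :
    ∫ x, Real.exp (-(t * ∑ i, x i ^ 2)) ∂(Measure.pi fun i ↦ gaussianReal (m i) v) =
      (1 + 2 * t * v) ^ (-(Fintype.card ι / 2 : ℝ)) *
        Real.exp (-(t * (∑ i, m i ^ 2) / (1 + 2 * t * v))) := by
  have hw : 0 < 1 + 2 * t * v := by positivity
  simp_rw [exp_neg_mul_sum_sq]
  rw [integral_fintype_prod_eq_prod (fun _ y ↦ Real.exp (-(t * y ^ 2)))]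
  simp_rw [integral_exp_neg_mul_sq_gaussianReal _ hv ht]
  rw [Finset.prod_mul_distrib, ← Real.exp_sum, Finset.prod_const, Finset.card_univ,
    Finset.sum_neg_distrib, ← Finset.sum_div, ← Finset.mul_sum, Real.sqrt_eq_rpow,
    ← Real.rpow_neg hw.le, ← Real.rpow_natCast, ← Real.rpow_mul hw.le]
  congr 2
  ring

lemma integral_eval_mul_exp_neg_mul_sum_sq_pi_gaussianReal (m : ι → ℝ) {v : ℝ≥0} (hv : v ≠ 0)
    {t : ℝ} (ht : 0 ≤ t) (j : ι) :
    ∫ x, x j * Real.exp (-(t * ∑ i, x i ^ 2)) ∂(Measure.pi fun i ↦ gaussianReal (m i) v) =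
      m j * ((1 + 2 * t * v) ^ (-(Fintype.card ι / 2 + 1 : ℝ)) *
        Real.exp (-(t * (∑ i, m i ^ 2) / (1 + 2 * t * v)))) := by
  classical
  have hw : 0 < 1 + 2 * t * v := by positivity
  have hx (x : ι → ℝ) : x j * Real.exp (-(t * ∑ i, x i ^ 2)) =
      ∏ i, (if i = j then x i else 1) * Real.exp (-(t * x i ^ 2)) := by
    rw [Finset.prod_mul_distrib, exp_neg_mul_sum_sq]
    simp
  have hI (i : ι) : ∫ y, (if i = j then y else 1) * Real.exp (-(t * y ^ 2))
      ∂gaussianReal (m i) v = (if i = j then m i / (1 + 2 * t * v) else 1) *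
        ∫ y, Real.exp (-(t * y ^ 2)) ∂gaussianReal (m i) v := by
    split_ifs
    · rw [integral_id_mul_exp_neg_mul_sq_gaussianReal _ hv ht,
        integral_exp_neg_mul_sq_gaussianReal _ hv ht]
    · simp
  simp_rw [hx]
  rw [integral_fintype_prod_eq_prod
    (fun i y ↦ (if i = j then y else 1) * Real.exp (-(t * y ^ 2)))]
  simp_rw [hI]
  rw [Finset.prod_mul_distrib, ← integral_fintype_prod_eq_prod (fun _ y ↦ Real.exp (-(t * y ^ 2)))]
  simp_rw [← exp_neg_mul_sum_sq]
  rw [integral_exp_neg_mul_sum_sq_pi_gaussianReal m hv ht, neg_add, Real.rpow_add hw,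
    Real.rpow_neg_one]
  simp
  ring
end

section
variable {a v : ℝ}

lemma hasDerivAt_one_add_two_mul_rpow (ha : 1 < a) (hv : 0 < v) {t : ℝ} (ht : 0 ≤ t) :
    HasDerivAt (fun t : ℝ ↦ -((2 * v * (a - 1))⁻¹ * (1 + 2 * t * v) ^ (-(a - 1))))
      ((1 + 2 * t * v) ^ (-a)) t := by
  have hw : 0 < 1 + 2 * t * v := by positivity
  have h1 : HasDerivAt (fun t : ℝ ↦ 1 + 2 * t * v) (2 * v) t := by
    simpa using (((hasDerivAt_id t).const_mul 2).mul_const v).const_add 1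
  have h2 := ((h1.rpow_const (p := -(a - 1)) (Or.inl hw.ne')).const_mul (2 * v * (a - 1))⁻¹).neg
  refine h2.congr_deriv ?_
  have : a - 1 ≠ 0 := by linarith
  rw [show -(a - 1) - 1 = -a by ring]
  field_simp

lemma tendsto_one_add_two_mul_rpow (ha : 1 < a) (hv : 0 < v) :
    Tendsto (fun t : ℝ ↦ -((2 * v * (a - 1))⁻¹ * (1 + 2 * t * v) ^ (-(a - 1)))) atTop (𝓝 0) := by
  have h1 : Tendsto (fun t : ℝ ↦ 1 + 2 * t * v) atTop atTop :=
    tendsto_atTop_add_const_left _ _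
      ((tendsto_id.const_mul_atTop two_pos).atTop_mul_const hv)
  simpa using (((tendsto_rpow_neg_atTop (sub_pos.2 ha)).comp h1).const_mul
    (2 * v * (a - 1))⁻¹).neg

lemma integrableOn_one_add_two_mul_rpow (ha : 1 < a) (hv : 0 < v) :
    IntegrableOn (fun t : ℝ ↦ (1 + 2 * t * v) ^ (-a)) (Ioi 0) :=
  integrableOn_Ioi_deriv_of_nonneg'
    (fun _ ht ↦ hasDerivAt_one_add_two_mul_rpow ha hv ht)
    (fun t ht ↦ by have : (0 : ℝ) < t := ht
                   positivity)
    (tendsto_one_add_two_mul_rpow ha hv)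

lemma integral_one_add_two_mul_rpow (ha : 1 < a) (hv : 0 < v) :
    ∫ t in Ioi (0 : ℝ), (1 + 2 * t * v) ^ (-a) = (2 * v * (a - 1))⁻¹ := by
  rw [integral_Ioi_of_hasDerivAt_of_tendsto'
    (fun _ ht ↦ hasDerivAt_one_add_two_mul_rpow ha hv ht)
    (integrableOn_one_add_two_mul_rpow ha hv) (tendsto_one_add_two_mul_rpow ha hv)]
  simp

lemma hasSum_integral_rpow_mul_exp {d κ : ℝ} (hd : 0 < d) (hκ : 0 ≤ κ) (hv : 0 < v) :
    HasSum (fun k : ℕ ↦ κ ^ k * Real.exp (-κ) / k.factorial * (2 * v * (d + k))⁻¹)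
      (∫ t in Ioi (0 : ℝ), (1 + 2 * t * v) ^ (-(d + 1)) *
        Real.exp (-(t * (2 * v * κ) / (1 + 2 * t * v)))) := by
  set F : ℕ → ℝ → ℝ := fun k t ↦
    κ ^ k * Real.exp (-κ) / k.factorial * (1 + 2 * t * v) ^ (-(d + k + 1)) with hF
  have ha (k : ℕ) : 1 < d + k + 1 := by linarith [hd, (k.cast_nonneg : (0 : ℝ) ≤ k)]
  have hint (k : ℕ) : ∫ t in Ioi (0 : ℝ), F k t =
      κ ^ k * Real.exp (-κ) / k.factorial * (2 * v * (d + k))⁻¹ := by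
    simp_rw [hF]
    rw [integral_const_mul, integral_one_add_two_mul_rpow (ha k) hv, add_sub_cancel_right]
  have hnorm (k : ℕ) : ∫ t in Ioi (0 : ℝ), ‖F k t‖ = ∫ t in Ioi (0 : ℝ), F k t := by
    refine setIntegral_congr_fun measurableSet_Ioi fun t ht ↦ ?_
    have : (0 : ℝ) < t := ht
    exact Real.norm_of_nonneg (by positivity)
  have hsum : Summable fun k ↦ ∫ t in Ioi (0 : ℝ), ‖F k t‖ := by
    simp_rw [hnorm, hint]
    refine Summable.of_nonneg_of_le (fun k ↦ by positivity) (fun k ↦ ?_)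
      (((Real.summable_pow_div_factorial κ).mul_left (Real.exp (-κ))).mul_right (2 * v * d)⁻¹)
    rw [show Real.exp (-κ) * (κ ^ k / k.factorial) = κ ^ k * Real.exp (-κ) / k.factorial by ring]
    gcongr
    simp
  have key : HasSum (fun k ↦ ∫ t in Ioi (0 : ℝ), F k t) (∫ t in Ioi (0 : ℝ), ∑' k, F k t) :=
    hasSum_integral_of_summable_integral_norm (fun k ↦ (integrableOn_one_add_two_mul_rpow (ha k) hv).const_mul _) hsum
  simp_rw [hint] at key
  suffices H : EqOn (fun t ↦ ∑' k, F k t) (fun t ↦ (1 + 2 * t * v) ^ (-(d + 1)) *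
      Real.exp (-(t * (2 * v * κ) / (1 + 2 * t * v)))) (Ioi 0) by
    rwa [setIntegral_congr_fun measurableSet_Ioi H] at key
  intro t ht
  have ht : (0 : ℝ) < t := ht
  have hw : 0 < 1 + 2 * t * v := by positivity
  have hexp : -(t * (2 * v * κ) / (1 + 2 * t * v)) = -κ + κ / (1 + 2 * t * v) := by
    field_simp
    ring
  have hs := (NormedSpace.expSeries_div_hasSum_exp (κ / (1 + 2 * t * v))).mul_left
    ((1 + 2 * t * v) ^ (-(d + 1)) * Real.exp (-κ))
  rw [← Real.exp_eq_exp_ℝ] at hs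
  beta_reduce
  rw [hexp, Real.exp_add, ← mul_assoc, ← hs.tsum_eq]
  refine tsum_congr fun k ↦ ?_
  simp only [hF]
  rw [show -(d + k + 1) = -(d + 1) + -(k : ℝ) by ring, Real.rpow_add hw,
    Real.rpow_neg hw.le k, Real.rpow_natCast, div_pow]
  ring

end

section
variable {ι : Type*} [Fintype ι] {m : ι → ℝ} {v : ℝ≥0}

lemma ae_sum_sq_pos_pi_gaussianReal [Nonempty ι] (hv : v ≠ 0) :
    ∀ᵐ x ∂(Measure.pi fun i ↦ gaussianReal (m i) v), 0 < ∑ i, x i ^ 2 := by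
  obtain ⟨j⟩ := ‹Nonempty ι›
  have := nullSingletonClass_gaussianReal (μ := m j) hv
  filter_upwards [Measure.ae_eval_ne (fun i ↦ gaussianReal (m i) v) j 0] with x hx
  exact Finset.sum_pos' (fun i _ ↦ sq_nonneg _) ⟨j, Finset.mem_univ j, by positivity⟩

lemma integral_exp_neg_mul_Ioi_zero {q : ℝ} (hq : 0 < q) :
    ∫ t in Ioi (0 : ℝ), Real.exp (-(t * q)) = q⁻¹ := by
  have := integral_exp_mul_Ioi (neg_neg_of_pos hq) 0
  simpa [mul_comm, div_eq_mul_inv] using this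

lemma integrableOn_exp_neg_mul_Ioi_zero {q : ℝ} (hq : 0 < q) :
    IntegrableOn (fun t : ℝ ↦ Real.exp (-(t * q))) (Ioi 0) := by
  simpa [mul_comm] using integrableOn_exp_mul_Ioi (neg_neg_of_pos hq) 0

lemma integrable_exp_neg_mul_sum_sq_prod (hv : v ≠ 0) (hι : 2 < Fintype.card ι) :
    Integrable (fun p : (ι → ℝ) × ℝ ↦ Real.exp (-(p.2 * ∑ i, p.1 i ^ 2)))
      ((Measure.pi fun i ↦ gaussianReal (m i) v).prod (volume.restrict (Ioi 0))) := by
  have hmeas : Measurable (fun p : (ι → ℝ) × ℝ ↦ Real.exp (-(p.2 * ∑ i, p.1 i ^ 2))) := by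
    fun_prop
  have hv0 : (0 : ℝ) < v := by positivity
  rw [integrable_prod_iff' hmeas.aestronglyMeasurable]
  constructor
  · filter_upwards [ae_restrict_mem measurableSet_Ioi] with t ht
    have ht : (0 : ℝ) < t := ht
    refine Integrable.of_bound (Measurable.aestronglyMeasurable (by fun_prop)) 1 (.of_forall fun x ↦ ?_)
    rw [Real.norm_of_nonneg (Real.exp_nonneg _), Real.exp_le_one_iff, neg_nonpos]
    have : 0 ≤ ∑ i, x i ^ 2 := Finset.sum_nonneg fun i _ ↦ sq_nonneg _
    positivity
  · have hι' : (1 : ℝ) < Fintype.card ι / 2 := by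
      have : (2 : ℝ) < Fintype.card ι := by exact_mod_cast hι
      linarith
    refine (integrableOn_one_add_two_mul_rpow hι' hv0).mono'
      hmeas.aestronglyMeasurable.norm.prod_swap.integral_prod_right' ?_
    filter_upwards [ae_restrict_mem measurableSet_Ioi] with t ht
    have ht : (0 : ℝ) < t := ht
    simp_rw [Real.norm_of_nonneg (Real.exp_nonneg _)]
    rw [integral_exp_neg_mul_sum_sq_pi_gaussianReal m hv ht.le, Real.norm_of_nonneg (by positivity)]
    refine mul_le_of_le_one_right (by positivity) ?_
    rw [Real.exp_le_one_iff, neg_nonpos]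
    have : 0 ≤ ∑ i, m i ^ 2 := Finset.sum_nonneg fun i _ ↦ sq_nonneg _
    positivity

lemma integrable_inv_sum_sq_pi_gaussianReal (hv : v ≠ 0) (hι : 2 < Fintype.card ι) :
    Integrable (fun x : ι → ℝ ↦ (∑ i, x i ^ 2)⁻¹)
      (Measure.pi fun i ↦ gaussianReal (m i) v) := by
  have : Nonempty ι := Fintype.card_pos_iff.1 (by omega)
  refine (integrable_exp_neg_mul_sum_sq_prod hv hι).integral_prod_left.congr ?_
  filter_upwards [ae_sum_sq_pos_pi_gaussianReal hv] with x hx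
  exact integral_exp_neg_mul_Ioi_zero hx

lemma integrable_eval_div_sum_sq_pi_gaussianReal (hv : v ≠ 0) (hι : 2 < Fintype.card ι) (j : ι) :
    Integrable (fun x : ι → ℝ ↦ x j / ∑ i, x i ^ 2)
      (Measure.pi fun i ↦ gaussianReal (m i) v) := by
  have : Nonempty ι := ⟨j⟩
  refine ((integrable_inv_sum_sq_pi_gaussianReal hv hι).add (integrable_const 1)).mono'
    (Measurable.aestronglyMeasurable (by fun_prop)) ?_
  filter_upwards [ae_sum_sq_pos_pi_gaussianReal hv] with x hx
  have hj : x j ^ 2 ≤ ∑ i, x i ^ 2 :=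
    Finset.single_le_sum (fun i _ ↦ sq_nonneg (x i)) (Finset.mem_univ j)
  simp only [Pi.add_apply]
  rw [norm_div, Real.norm_of_nonneg hx.le, Real.norm_eq_abs, div_le_iff₀ hx, add_mul,
    inv_mul_cancel₀ hx.ne', one_mul]
  nlinarith [sq_abs (x j), sq_nonneg (|x j| - 1)]

lemma integral_eval_div_sum_sq_pi_gaussianReal (hv : v ≠ 0) (hι : 2 < Fintype.card ι) (j : ι) :
    ∫ x, x j / ∑ i, x i ^ 2 ∂(Measure.pi fun i ↦ gaussianReal (m i) v) =
      m j * ∫ t in Ioi (0 : ℝ), (1 + 2 * t * v) ^ (-(Fintype.card ι / 2 + 1 : ℝ)) *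
        Real.exp (-(t * (∑ i, m i ^ 2) / (1 + 2 * t * v))) := by
  have : Nonempty ι := ⟨j⟩
  have hpos := ae_sum_sq_pos_pi_gaussianReal (m := m) hv
  have hint : Integrable (Function.uncurry fun (x : ι → ℝ) (t : ℝ) ↦
      x j * Real.exp (-(t * ∑ i, x i ^ 2)))
      ((Measure.pi fun i ↦ gaussianReal (m i) v).prod (volume.restrict (Ioi 0))) := by
    rw [integrable_prod_iff (Measurable.aestronglyMeasurable (by fun_prop))]
    constructor
    · filter_upwards [hpos] with x hx
      exact (integrableOn_exp_neg_mul_Ioi_zero hx).const_mul _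
    · refine (integrable_eval_div_sum_sq_pi_gaussianReal hv hι j).norm.congr ?_
      filter_upwards [hpos] with x hx
      simp_rw [Function.uncurry_apply_pair, norm_mul, Real.norm_of_nonneg (Real.exp_nonneg _)]
      rw [integral_const_mul, integral_exp_neg_mul_Ioi_zero hx, norm_div,
        Real.norm_of_nonneg hx.le, div_eq_mul_inv]
  calc ∫ x, x j / ∑ i, x i ^ 2 ∂(Measure.pi fun i ↦ gaussianReal (m i) v)
      = ∫ x, (∫ t in Ioi (0 : ℝ), x j * Real.exp (-(t * ∑ i, x i ^ 2)))
          ∂(Measure.pi fun i ↦ gaussianReal (m i) v) := by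
        refine integral_congr_ae ?_
        filter_upwards [hpos] with x hx
        rw [integral_const_mul, integral_exp_neg_mul_Ioi_zero hx, div_eq_mul_inv]
    _ = _ := by
        rw [integral_integral_swap hint, ← integral_const_mul]
        refine setIntegral_congr_fun measurableSet_Ioi fun t ht ↦ ?_
        exact integral_eval_mul_exp_neg_mul_sum_sq_pi_gaussianReal m hv (le_of_lt ht) j

lemma hasSum_integral_inner_div_sum_sq_pi_gaussianReal (hv : v ≠ 0) (hι : 2 < Fintype.card ι)
    {κ : ℝ} (hκ : κ = (∑ i, m i ^ 2) / (2 * v)) :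
    HasSum (fun k : ℕ ↦ κ ^ k * Real.exp (-κ) / k.factorial * (κ * ((Fintype.card ι : ℝ) / 2 + k)⁻¹))
      (∫ x, (∑ i, m i * x i) / ∑ i, x i ^ 2 ∂(Measure.pi fun i ↦ gaussianReal (m i) v)) := by
  have hv0 : (0 : ℝ) < v := by positivity
  have hM : ∑ i, m i ^ 2 = 2 * v * κ := by rw [hκ]; field_simp
  have hκ0 : 0 ≤ κ := by
    rw [hκ]
    exact div_nonneg (Finset.sum_nonneg fun i _ ↦ sq_nonneg _) (by positivity)
  have hd : (0 : ℝ) < Fintype.card ι / 2 := by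
    have : (2 : ℝ) < Fintype.card ι := by exact_mod_cast hι
    linarith
  simp_rw [Finset.sum_div, mul_div_assoc]
  rw [integral_finsetSum _ fun i _ ↦
    (integrable_eval_div_sum_sq_pi_gaussianReal hv hι i).const_mul _]
  simp_rw [integral_const_mul, integral_eval_div_sum_sq_pi_gaussianReal hv hι, ← mul_assoc, ← sq,
    ← Finset.sum_mul, hM]
  refine ((hasSum_integral_rpow_mul_exp hd hκ0 hv0).mul_left (2 * v * κ)).congr_fun fun k ↦ ?_
  have : (Fintype.card ι / 2 + k : ℝ) ≠ 0 := by positivity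
  field_simp

lemma hasSum_one_sub_integral_inner_div_sum_sq_pi_gaussianReal (hv : v ≠ 0)
    (hι : 2 < Fintype.card ι) {κ : ℝ} (hκ : κ = (∑ i, m i ^ 2) / (2 * v)) :
    HasSum (fun k : ℕ ↦ ((Fintype.card ι : ℝ) - 2) / ((Fintype.card ι : ℝ) - 2 + 2 * k) *
        (κ ^ k * Real.exp (-κ) / k.factorial))
      (1 - ∫ x, (∑ i, m i * x i) / ∑ i, x i ^ 2 ∂(Measure.pi fun i ↦ gaussianReal (m i) v)) := by
  have hn : (2 : ℝ) < Fintype.card ι := by exact_mod_cast hι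
  have h := hasSum_integral_inner_div_sum_sq_pi_gaussianReal hv hι hκ
  have hexp : HasSum (fun k : ℕ ↦ κ ^ k * Real.exp (-κ) / k.factorial) 1 := by
    have := (NormedSpace.expSeries_div_hasSum_exp κ).mul_right (Real.exp (-κ))
    rw [← Real.exp_eq_exp_ℝ, ← Real.exp_add, add_neg_cancel, Real.exp_zero] at this
    exact this.congr_fun fun k ↦ by ring
  set G : ℕ → ℝ := fun k ↦ κ ^ k * Real.exp (-κ) / k.factorial *
    (2 * k / ((Fintype.card ι : ℝ) - 2 + 2 * k)) with hG
  have hGsum : HasSum G (∫ x, (∑ i, m i * x i) / ∑ i, x i ^ 2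
      ∂(Measure.pi fun i ↦ gaussianReal (m i) v)) := by
    rw [← hasSum_nat_add_iff' 1, Finset.sum_range_one, show G 0 = 0 by simp [hG], sub_zero]
    refine h.congr_fun fun k ↦ ?_
    have : ((Fintype.card ι : ℝ) / 2 + k) ≠ 0 := by positivity
    have h2 : (Fintype.card ι : ℝ) - 2 + 2 * (k + 1) = 2 * (Fintype.card ι / 2 + k) := by ring
    rw [hG]
    push_cast [Nat.factorial_succ]
    rw [h2, pow_succ]
    field_simp
  refine (hexp.sub hGsum).congr_fun fun k ↦ ?_
  have : (Fintype.card ι : ℝ) - 2 + 2 * k ≠ 0 := by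
    have := (k.cast_nonneg : (0 : ℝ) ≤ k)
    linarith
  rw [hG]
  field_simp
  ring

end

lemma measurePreserving_lawX_inl (ℓ s : ℕ) (μ : Fin ℓ → ℝ) (τ : ℝ) :
    MeasurePreserving (fun (x : Fin ℓ ⊕ Fin s → ℝ) i ↦ x (Sum.inl i)) (lawX ℓ s μ τ)
      (Measure.pi fun i ↦ gaussianReal (μ i) (τ ^ 2).toNNReal) :=
  measurePreserving_fst.comp (measurePreserving_sumPiEquivProdPi
    fun i ↦ gaussianReal (Sum.elim μ (0 : Fin s → ℝ) i) (τ ^ 2).toNNReal)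

lemma integral_tsls_lawYgiven (ℓ s : ℕ) (μ : Fin ℓ → ℝ) (β ρ σ τ : ℝ)
    (x : Fin ℓ ⊕ Fin s → ℝ) :
    ∫ y, (∑ i, y (Sum.inl i) * x (Sum.inl i)) / (∑ i, x (Sum.inl i) ^ 2)
        ∂(lawYgiven ℓ s μ β ρ σ τ x) =
      (∑ i, (x (Sum.inl i) * β + (x (Sum.inl i) - μ i) * (ρ * σ / τ)) * x (Sum.inl i)) /
        (∑ i, x (Sum.inl i) ^ 2) := by
  have hint (i : Fin ℓ ⊕ Fin s) : Integrable (fun y ↦ y i) (lawYgiven ℓ s μ β ρ σ τ x) :=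
    integrable_eval ((memLp_id_gaussianReal 1).integrable le_rfl)
  have hval (i : Fin ℓ ⊕ Fin s) : ∫ y, y i ∂(lawYgiven ℓ s μ β ρ σ τ x) =
      x i * β + (x i - Sum.elim μ (0 : Fin s → ℝ) i) * (ρ * σ / τ) := by
    rw [lawYgiven, integral_eval, integral_id_gaussianReal]
  rw [integral_div, integral_finsetSum _ fun i _ ↦ (hint _).mul_const _]
  simp_rw [integral_mul_const, hval, Sum.elim_inl]

lemma integral_tsls (ℓ s : ℕ) (hℓ : 3 ≤ ℓ) (μ : Fin ℓ → ℝ) (β ρ σ τ : ℝ) (hτ : 0 < τ) :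
    ∫ x, ∫ y, (∑ i, y (Sum.inl i) * x (Sum.inl i)) / (∑ i, x (Sum.inl i) ^ 2)
        ∂(lawYgiven ℓ s μ β ρ σ τ x) ∂(lawX ℓ s μ τ) =
      β + ρ * σ / τ * (1 - ∫ x, (∑ i, μ i * x i) / ∑ i, x i ^ 2
        ∂(Measure.pi fun i ↦ gaussianReal (μ i) (τ ^ 2).toNNReal)) := by
  have hv : (τ ^ 2).toNNReal ≠ 0 := by simpa using hτ.ne'
  have : Nonempty (Fin ℓ) := ⟨⟨0, by omega⟩⟩
  have hint : Integrable (fun x : Fin ℓ → ℝ ↦ (∑ i, μ i * x i) / ∑ i, x i ^ 2)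
      (Measure.pi fun i ↦ gaussianReal (μ i) (τ ^ 2).toNNReal) := by
    simp_rw [Finset.sum_div, mul_div_assoc]
    exact integrable_finsetSum _ fun i _ ↦
      (integrable_eval_div_sum_sq_pi_gaussianReal hv (by rw [Fintype.card_fin]; omega) i).const_mul _
  simp_rw [integral_tsls_lawYgiven]
  rw [← (measurePreserving_lawX_inl ℓ s μ τ).map_eq] at hint
  have hg : AEStronglyMeasurable (fun x : Fin ℓ → ℝ ↦
      (∑ i, (x i * β + (x i - μ i) * (ρ * σ / τ)) * x i) / ∑ i, x i ^ 2)
      ((lawX ℓ s μ τ).map fun x i ↦ x (Sum.inl i)) :=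
    Measurable.aestronglyMeasurable (by fun_prop)
  have hmap := integral_map (measurePreserving_lawX_inl ℓ s μ τ).aemeasurable hg
  rw [← hmap]
  rw [(measurePreserving_lawX_inl ℓ s μ τ).map_eq] at hint ⊢
  calc _ = ∫ x : Fin ℓ → ℝ, (β + ρ * σ / τ * (1 - (∑ i, μ i * x i) / ∑ i, x i ^ 2))
          ∂(Measure.pi fun i ↦ gaussianReal (μ i) (τ ^ 2).toNNReal) := by
        refine integral_congr_ae ?_
        filter_upwards [ae_sum_sq_pos_pi_gaussianReal hv] with x hx
        have hsum : ∑ i, (x i * β + (x i - μ i) * (ρ * σ / τ)) * x i =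
            (β + ρ * σ / τ) * ∑ i, x i ^ 2 - ρ * σ / τ * ∑ i, μ i * x i := by
          rw [Finset.mul_sum, Finset.mul_sum, ← Finset.sum_sub_distrib]
          exact Finset.sum_congr rfl fun i _ ↦ by ring
        rw [hsum, sub_div, mul_div_assoc, div_self hx.ne']
        ring
    _ = _ := by
        have hint' : Integrable (fun x : Fin ℓ → ℝ ↦ 1 - (∑ i, μ i * x i) / ∑ i, x i ^ 2)
            (Measure.pi fun i ↦ gaussianReal (μ i) (τ ^ 2).toNNReal) :=
          (integrable_const 1).sub hint
        rw [integral_add (integrable_const _) (hint'.const_mul _), integral_const_mul,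
          integral_sub (integrable_const _) hint]
        simp

/-- bias of 2SLS. In the canonical two-stage model with `ℓ ≥ 3`,
the two-stage least-squares estimator `β̂_2SLS = (Y*_z)'X*_z/‖X*_z‖²` satisfies
`E[β̂_2SLS] − β = (ρσ/τ) ∑_{k} ((ℓ−2)/(ℓ−2+2k)) κ^k e^{−κ}/k!` with
`κ = ‖μ‖²/(2τ²)`; in particular the bias has the same sign as `ρ` and is nonzero
whenever `ρ ≠ 0`. The expectation over the joint law of `(X*, Y*)` is written as an
iterated integral against the marginal law of `X*` and the conditional Gaussian law of
`Y*` given `X*`. -/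
theorem tsls_bias_formula (ℓ s : ℕ) (hℓ : 3 ≤ ℓ) (hs : 1 ≤ s)
    (μ : Fin ℓ → ℝ) (β ρ σ τ : ℝ)
    (hρ₁ : -1 < ρ) (hρ₂ : ρ < 1) (hσ : 0 < σ) (hτ : 0 < τ)
    (κ : ℝ) (hκ : κ = (∑ i, μ i ^ 2) / (2 * τ ^ 2))
    (E2SLS : ℝ)
    (hE2SLS : E2SLS = ∫ x, ∫ y,
        (∑ i, y (Sum.inl i) * x (Sum.inl i)) / (∑ i, x (Sum.inl i) ^ 2)
        ∂(lawYgiven ℓ s μ β ρ σ τ x) ∂(lawX ℓ s μ τ)) :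
    E2SLS - β = (ρ * σ / τ) * ∑' k : ℕ,
        (((ℓ : ℝ) - 2) / ((ℓ : ℝ) - 2 + 2 * k))
          * (κ ^ k * Real.exp (-κ) / (Nat.factorial k)) ∧
    (0 < ρ → 0 < E2SLS - β) ∧
    (ρ < 0 → E2SLS - β < 0) ∧
    (ρ = 0 → E2SLS - β = 0) ∧
    (ρ ≠ 0 → E2SLS - β ≠ 0) := by
  have hv : (τ ^ 2).toNNReal ≠ 0 := by simpa using hτ.ne'
  have hsum := hasSum_one_sub_integral_inner_div_sum_sq_pi_gaussianReal (m := μ) (κ := κ) hv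
    (by rw [Fintype.card_fin]; omega) (by rw [hκ, Real.coe_toNNReal _ (sq_nonneg τ)])
  rw [Fintype.card_fin] at hsum
  have hbias : E2SLS - β = (ρ * σ / τ) * ∑' k : ℕ, (((ℓ : ℝ) - 2) / ((ℓ : ℝ) - 2 + 2 * k))
      * (κ ^ k * Real.exp (-κ) / (Nat.factorial k)) := by
    rw [hE2SLS, integral_tsls ℓ s hℓ μ β ρ σ τ hτ, hsum.tsum_eq]
    ring
  have hℓ2 : (0 : ℝ) < (ℓ : ℝ) - 2 := by
    have : (3 : ℝ) ≤ ℓ := by exact_mod_cast hℓ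
    linarith
  have hκ0 : 0 ≤ κ := by
    rw [hκ]
    exact div_nonneg (Finset.sum_nonneg fun i _ ↦ sq_nonneg _) (by positivity)
  have hpos : 0 < ∑' k : ℕ, (((ℓ : ℝ) - 2) / ((ℓ : ℝ) - 2 + 2 * k))
      * (κ ^ k * Real.exp (-κ) / (Nat.factorial k)) := by
    refine hsum.summable.tsum_pos (fun k ↦ by positivity) 0 ?_
    simp only [pow_zero]
    positivity
  have hρpos (hρ : 0 < ρ) : 0 < E2SLS - β := by
    rw [hbias]
    positivity
  have hρneg (hρ : ρ < 0) : E2SLS - β < 0 := by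
    rw [hbias]
    exact mul_neg_of_neg_of_pos (div_neg_of_neg_of_pos (mul_neg_of_neg_of_pos hρ hσ) hτ) hpos
  refine ⟨hbias, hρpos, hρneg, fun hρ ↦ by simp [hbias, hρ], fun hρ ↦ ?_⟩
  rcases hρ.lt_or_gt with h | h
  · exact (hρneg h).ne
  · exact (hρpos h).ne'
end

section
/- Let a ≥ 1 be a real number and let K be a Poisson random variable with mean ν > 0. Then E[1/(a + K)] ≤ 1/(a + ν − 1), i.e., ∑_{k=0}^∞ (1/(a+k))·ν^k e^{−ν}/k! ≤ 1/(a + ν − 1). -/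
/-- The Poisson weights sum to one. -/
lemma hasSum_poisson_weight (ν : ℝ) :
    HasSum (fun k : ℕ => ν ^ k * Real.exp (-ν) / (Nat.factorial k)) 1 := by
  have h := (NormedSpace.expSeries_div_hasSum_exp (𝔸 := ℝ) ν).mul_right (Real.exp (-ν))
  rw [← Real.exp_eq_exp_ℝ, ← Real.exp_add, add_neg_cancel, Real.exp_zero] at h
  refine h.congr_fun fun k => ?_
  ring

/-- Let `a ≥ 1` and let `K` be a Poisson random variable with mean `ν > 0`.
Then `E[1/(a + K)] ≤ 1/(a + ν − 1)`, where the expectation is the series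
`∑_{k} (1/(a+k)) ν^k e^{−ν}/k!`. -/
theorem poisson_inverse_moment_bound (a ν : ℝ) (ha : 1 ≤ a) (hν : 0 < ν) :
    (∑' k : ℕ, (1 / (a + k)) * (ν ^ k * Real.exp (-ν) / (Nat.factorial k)))
      ≤ 1 / (a + ν - 1) := by
  have hp := hasSum_poisson_weight ν
  set p : ℕ → ℝ := fun k => ν ^ k * Real.exp (-ν) / (Nat.factorial k) with hp_def
  have hp0 (k : ℕ) : 0 ≤ p k := by positivity
  have hpos (k : ℕ) : 0 < a + k := by positivity
  have hs : Summable fun k : ℕ => 1 / (a + k) * p k := by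
    refine hp.summable.of_nonneg_of_le
      (fun k => mul_nonneg (one_div_pos.2 (hpos k)).le (hp0 k)) fun k => ?_
    refine mul_le_of_le_one_left (hp0 k) ((div_le_one (hpos k)).2 ?_)
    linarith [Nat.cast_nonneg (α := ℝ) k]
  -- The Stein identity `ν E[g (K + 1)] = E[K g K]` with `g k = 1 / (a + k - 1)`.
  set f : ℕ → ℝ := fun k => k / (a + k - 1) * p k with hf_def
  have hshift (k : ℕ) : f (k + 1) = ν * (1 / (a + k) * p k) := by
    have hne := (hpos k).ne'
    have heq : a + ((k : ℝ) + 1) - 1 = a + k := by ring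
    simp only [hf_def, hp_def, Nat.factorial_succ, Nat.cast_mul, Nat.cast_succ, heq]
    field_simp
    ring
  have hfs : HasSum f (ν * ∑' k : ℕ, 1 / (a + k) * p k) := by
    rw [← hasSum_nat_add_iff' 1]
    have hf0 : f 0 = 0 := by simp [hf_def]
    simp only [Finset.sum_range_one, hf0, sub_zero, hshift]
    exact hs.hasSum.mul_left ν
  have hle (k : ℕ) : f k ≤ p k - (a - 1) * (1 / (a + k) * p k) := by
    have hcoef : (k : ℝ) / (a + k - 1) ≤ 1 - (a - 1) / (a + k) := by
      have hR : 1 - (a - 1) / (a + k) = (k + 1) / (a + k) := by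
        field_simp [(hpos k).ne']
        ring
      rw [hR]
      rcases k.eq_zero_or_pos with rfl | hk
      · simp only [Nat.cast_zero, zero_div]
        positivity
      · have hk' : (0 : ℝ) < k := Nat.cast_pos.2 hk
        rw [div_le_div_iff₀ (by linarith) (hpos k)]
        nlinarith
    calc f k ≤ (1 - (a - 1) / (a + k)) * p k := mul_le_mul_of_nonneg_right hcoef (hp0 k)
      _ = _ := by ring
  have hmain := hasSum_le hle hfs (hp.sub (hs.hasSum.mul_left (a - 1)))
  rw [le_div_iff₀ (by linarith)]
  linarith
end

section
/- Let ℓ ≥ 4 be an integer, μ ∈ ℝ^ℓ, τ > 0, and let M be a random vector in ℝ^ℓ with independent coordinates M_i ~ N(μ_i, τ²). Then both M/‖M‖⁴ and (M − μ)/‖M‖² are integrable vector-valued random variables, and E[(M − μ)/‖M‖²] = −2τ²·E[M/‖M‖⁴] (equality of vectors in ℝ^ℓ, componentwise). -/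
open MeasureTheory ProbabilityTheory

/-- The law of a random vector `M` in `ℝ^ℓ` with independent coordinates
`M_i ~ N(μ_i, τ²)`: the product of the real Gaussian measures. -/
noncomputable def gaussianVecLaw (ℓ : ℕ) (μ : Fin ℓ → ℝ) (τ : ℝ) :
    Measure (Fin ℓ → ℝ) :=
  Measure.pi fun i => gaussianReal (μ i) (τ ^ 2).toNNReal

/-- A real function is integrable for a nondegenerate Gaussian measure iff its product with the
density is Lebesgue integrable. -/
lemma integrable_gaussianReal_iff {μ : ℝ} {v : NNReal} (hv : v ≠ 0) {f : ℝ → ℝ} :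
    Integrable f (gaussianReal μ v) ↔ Integrable fun x => gaussianPDFReal μ v x * f x := by
  rw [gaussianReal_of_var_ne_zero _ hv, integrable_withDensity_iff_integrable_smul'
    (measurable_gaussianPDF _ _) (ae_of_all _ fun _ => gaussianPDF_lt_top)]
  simp [toReal_gaussianPDF]

lemma gaussianPDFReal_le (μ : ℝ) (v : NNReal) (x : ℝ) :
    gaussianPDFReal μ v x ≤ (√(2 * Real.pi * v))⁻¹ := by
  rw [gaussianPDFReal]
  refine mul_le_of_le_one_right (by positivity) (Real.exp_le_one_iff.2 ?_)
  exact div_nonpos_of_nonpos_of_nonneg (neg_nonpos.2 (sq_nonneg _)) (by positivity)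

lemma MeasureTheory.Integrable.gaussianReal {μ : ℝ} {v : NNReal} (hv : v ≠ 0) {f : ℝ → ℝ}
    (hf : Integrable f) : Integrable f (gaussianReal μ v) := by
  rw [integrable_gaussianReal_iff hv]
  refine hf.bdd_mul (c := (√(2 * Real.pi * v))⁻¹)
    (measurable_gaussianPDFReal μ v).aestronglyMeasurable (ae_of_all _ fun x => ?_)
  rw [Real.norm_of_nonneg (gaussianPDFReal_nonneg _ _ _)]
  exact gaussianPDFReal_le μ v x

lemma integrable_abs_rpow_gaussianReal (μ : ℝ) {v : NNReal} (hv : v ≠ 0) {s : ℝ}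
    (hs : -1 < s) (hs0 : s ≤ 0) : Integrable (fun x => |x| ^ s) (gaussianReal μ v) := by
  have hball : IntegrableOn (fun x : ℝ => |x| ^ s) (Metric.ball 0 1) := by
    have := (integrableOn_fun_norm_addHaar (E := ℝ) volume (f := fun y : ℝ => y ^ s)
      (r := 1)).2
    simp only [Module.finrank_self, Nat.sub_self, pow_zero, one_smul, Real.norm_eq_abs] at this
    exact this ((intervalIntegral.integrableOn_Ioo_rpow_iff one_pos).2 hs)
  refine Integrable.mono' (((integrable_indicator_iff measurableSet_ball).2
    hball).gaussianReal hv |>.add (integrable_const (1 : ℝ)))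
    (Measurable.aestronglyMeasurable (by fun_prop)) (ae_of_all _ fun x => ?_)
  rw [Real.norm_of_nonneg (by positivity)]
  by_cases hx : x ∈ Metric.ball (0 : ℝ) 1
  · simp [Set.indicator_of_mem hx]
  · have : 1 ≤ |x| := by simpa using hx
    simpa [Set.indicator_of_notMem hx] using Real.rpow_le_one_of_one_le_of_nonpos this hs0

/-- **Stein's lemma** for bounded functions with bounded derivative. -/
lemma integral_sub_mul_gaussianReal (μ : ℝ) {v : NNReal} (hv : v ≠ 0) {f f' : ℝ → ℝ}
    (hf : ∀ x, HasDerivAt f (f' x) x) (hf' : Measurable f') {C C' : ℝ}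
    (hC : ∀ x, |f x| ≤ C) (hC' : ∀ x, |f' x| ≤ C') :
    ∫ x, (x - μ) * f x ∂gaussianReal μ v = v * ∫ x, f' x ∂gaussianReal μ v := by
  have hv' : (v : ℝ) ≠ 0 := by exact_mod_cast hv
  have hfm : Measurable f :=
    (continuous_iff_continuousAt.2 fun x => (hf x).continuousAt).measurable
  have hpdf : ∀ x, HasDerivAt (fun x => -v * gaussianPDFReal μ v x)
      ((x - μ) * gaussianPDFReal μ v x) x := by
    intro x
    have h1 : HasDerivAt (fun x : ℝ => -(x - μ) ^ 2 / (2 * v)) (-(x - μ) / v) x := by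
      refine ((((hasDerivAt_id x).sub_const μ).pow 2).neg.div_const (2 * (v : ℝ))).congr_deriv ?_
      simp; field_simp; ring
    refine ((h1.exp.const_mul ((√(2 * Real.pi * v))⁻¹)).const_mul (-(v : ℝ))).congr_deriv ?_
    simp only [gaussianPDFReal]
    field_simp
  have hid : Integrable (fun x => x - μ) (gaussianReal μ v) :=
    ((memLp_id_gaussianReal 1).integrable (by simp)).sub (integrable_const _)
  have hparts := integral_mul_deriv_eq_deriv_mul_of_integrable (fun x _ => hf x)
    (fun x _ => hpdf x)
    (((integrable_gaussianReal_iff hv).1 (hid.bdd_mul (c := C) hfm.aestronglyMeasurable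
      (ae_of_all _ hC))).congr (ae_of_all _ fun x => by simp; ring))
    (((integrable_gaussianPDFReal μ v).const_mul (-(v : ℝ))).bdd_mul (c := C')
      hf'.aestronglyMeasurable (ae_of_all _ hC'))
    (((integrable_gaussianPDFReal μ v).const_mul (-(v : ℝ))).bdd_mul (c := C)
      hfm.aestronglyMeasurable (ae_of_all _ hC))
  rw [integral_gaussianReal_eq_integral_smul hv, integral_gaussianReal_eq_integral_smul hv,
    ← integral_const_mul]
  calc _ = ∫ x, f x * ((x - μ) * gaussianPDFReal μ v x) := by congr with x; simp; ring
    _ = _ := by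
      rw [hparts, ← integral_neg]
      congr with x; simp; ring

lemma integral_sub_mul_inv_sq_add_gaussianReal (μ : ℝ) {v : NNReal} (hv : v ≠ 0) {c : ℝ}
    (hc : 0 < c) :
    ∫ x, (x ^ 2 + c)⁻¹ * (x - μ) ∂gaussianReal μ v
      = -(2 * v) * ∫ x, ((x ^ 2 + c) ^ 2)⁻¹ * x ∂gaussianReal μ v := by
  have hpos : ∀ x : ℝ, 0 < x ^ 2 + c := fun x => by positivity
  have hderiv : ∀ x : ℝ, HasDerivAt (fun x : ℝ => (x ^ 2 + c)⁻¹)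
      (-2 * (((x ^ 2 + c) ^ 2)⁻¹ * x)) x := by
    intro x
    refine ((((hasDerivAt_id x).pow 2).add_const c).inv (hpos x).ne').congr_deriv ?_
    simp; field_simp
  have h := integral_sub_mul_gaussianReal μ hv hderiv (by fun_prop) (C := c⁻¹)
    (C' := (1 + c⁻¹) * c⁻¹) (fun x => ?_) (fun x => ?_)
  · simp_rw [mul_comm _ (_ - μ)]
    rw [h, integral_const_mul]
    ring
  · rw [abs_of_pos (inv_pos.2 (hpos x))]
    exact inv_anti₀ hc (by nlinarith [sq_nonneg x])
  · have h1 : |2 * x| ≤ 1 + x ^ 2 :=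
      abs_le.2 ⟨by nlinarith [sq_nonneg (x + 1)], by nlinarith [sq_nonneg (x - 1)]⟩
    have h2 : 1 + x ^ 2 ≤ (1 + c⁻¹) * (x ^ 2 + c) := by
      have : (1 + c⁻¹) * (x ^ 2 + c) = x ^ 2 + c + c⁻¹ * x ^ 2 + 1 := by field_simp; ring
      have : 0 ≤ c⁻¹ * x ^ 2 := by positivity
      nlinarith
    have h3 : (x ^ 2 + c)⁻¹ ≤ c⁻¹ := inv_anti₀ hc (by nlinarith [sq_nonneg x])
    have h4 := hpos x
    calc |-2 * (((x ^ 2 + c) ^ 2)⁻¹ * x)| = ((x ^ 2 + c) ^ 2)⁻¹ * |2 * x| := by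
          rw [show -2 * (((x ^ 2 + c) ^ 2)⁻¹ * x) = -(((x ^ 2 + c) ^ 2)⁻¹ * (2 * x)) by ring,
            abs_neg, abs_mul, abs_of_nonneg (by positivity)]
      _ ≤ ((x ^ 2 + c) ^ 2)⁻¹ * ((1 + c⁻¹) * (x ^ 2 + c)) := by gcongr; linarith
      _ = (1 + c⁻¹) * (x ^ 2 + c)⁻¹ := by field_simp
      _ ≤ _ := by gcongr

lemma abs_apply_le_sqrt_sum_sq {ι : Type*} [Fintype ι] (m : ι → ℝ) (i : ι) :
    |m i| ≤ √(∑ i, m i ^ 2) :=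
  Real.abs_le_sqrt (Finset.single_le_sum (f := fun i => m i ^ 2)
    (fun _ _ => sq_nonneg _) (Finset.mem_univ i))

lemma ae_gaussianVecLaw_ne_zero (ℓ : ℕ) (μ : Fin ℓ → ℝ) {τ : ℝ} (hτ : 0 < τ) :
    ∀ᵐ m ∂gaussianVecLaw ℓ μ τ, ∀ i, m i ≠ 0 := by
  have hv : (τ ^ 2).toNNReal ≠ 0 := by simpa using hτ.ne'
  rw [ae_all_iff]
  intro i
  have := nullSingletonClass_gaussianReal (μ := μ i) hv
  have h : ∀ᵐ x ∂gaussianReal (μ i) (τ ^ 2).toNNReal, x ≠ 0 := Measure.ae_ne _ 0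
  exact (Measure.quasiMeasurePreserving_eval
    (fun i => gaussianReal (μ i) (τ ^ 2).toNNReal) i).ae h

lemma integrable_inv_sqrt_sum_sq_pow {ℓ k : ℕ} (hk : k < ℓ) (μ : Fin ℓ → ℝ) {τ : ℝ}
    (hτ : 0 < τ) :
    Integrable (fun m : Fin ℓ → ℝ => (√(∑ i, m i ^ 2))⁻¹ ^ k) (gaussianVecLaw ℓ μ τ) := by
  have hv : (τ ^ 2).toNNReal ≠ 0 := by simpa using hτ.ne'
  have hℓ : (0 : ℝ) < ℓ := by exact_mod_cast k.zero_le.trans_lt hk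
  set s : ℝ := -(k / ℓ) with hs
  have hs0 : s ≤ 0 := by rw [hs]; exact neg_nonpos.2 (by positivity)
  have hs1 : -1 < s := by
    rw [hs, neg_lt_neg_iff, div_lt_one hℓ]; exact_mod_cast hk
  have hprod : Integrable (fun m : Fin ℓ → ℝ => ∏ i, |m i| ^ s) (gaussianVecLaw ℓ μ τ) :=
    Integrable.fintype_prod (f := fun _ (x : ℝ) => |x| ^ s)
      fun i => integrable_abs_rpow_gaussianReal (μ i) hv hs1 hs0
  refine hprod.mono' (Measurable.aestronglyMeasurable (by fun_prop)) ?_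
  filter_upwards [ae_gaussianVecLaw_ne_zero ℓ μ hτ] with m hm
  calc ‖(√(∑ i, m i ^ 2))⁻¹ ^ k‖ = (√(∑ i, m i ^ 2))⁻¹ ^ k :=
        Real.norm_of_nonneg (by positivity)
    _ = ∏ _i : Fin ℓ, √(∑ i, m i ^ 2) ^ s := by
      rw [Finset.prod_const, Finset.card_univ, Fintype.card_fin, ← Real.rpow_natCast _ ℓ,
        ← Real.rpow_mul (by positivity), hs, neg_mul, div_mul_cancel₀ _ hℓ.ne',
        Real.rpow_neg (by positivity), Real.rpow_natCast, inv_pow]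
    _ ≤ ∏ i, |m i| ^ s := Finset.prod_le_prod (fun _ _ => by positivity) fun i _ =>
      Real.rpow_le_rpow_of_nonpos (abs_pos.2 (hm i)) (abs_apply_le_sqrt_sum_sq m i) hs0

lemma integrable_inv_sum_sq_sq_mul {ℓ : ℕ} (hℓ : 3 < ℓ) (μ : Fin ℓ → ℝ) {τ : ℝ} (hτ : 0 < τ)
    (i : Fin ℓ) :
    Integrable (fun m : Fin ℓ → ℝ => ((∑ i, m i ^ 2) ^ 2)⁻¹ * m i) (gaussianVecLaw ℓ μ τ) := by
  refine (integrable_inv_sqrt_sum_sq_pow hℓ μ hτ).mono' (by fun_prop) ?_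
  filter_upwards [ae_gaussianVecLaw_ne_zero ℓ μ hτ] with m hm
  have habs := abs_apply_le_sqrt_sum_sq m i
  have hpos := (abs_pos.2 (hm i)).trans_le habs
  have hsq : ∑ i, m i ^ 2 = √(∑ i, m i ^ 2) ^ 2 := (Real.sq_sqrt (by positivity)).symm
  rw [norm_mul, Real.norm_of_nonneg (by positivity), Real.norm_eq_abs]
  generalize √(∑ i, m i ^ 2) = r at *
  rw [hsq]
  calc ((r ^ 2) ^ 2)⁻¹ * |m i| ≤ ((r ^ 2) ^ 2)⁻¹ * r := by gcongr
    _ = r⁻¹ ^ 3 := by field_simp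

lemma integrable_inv_sum_sq_mul_sub {ℓ : ℕ} (hℓ : 2 < ℓ) (μ : Fin ℓ → ℝ) {τ : ℝ} (hτ : 0 < τ)
    (i : Fin ℓ) :
    Integrable (fun m : Fin ℓ → ℝ => (∑ i, m i ^ 2)⁻¹ * (m i - μ i)) (gaussianVecLaw ℓ μ τ) := by
  refine ((integrable_inv_sqrt_sum_sq_pow (k := 1) (by lia) μ hτ).add
    ((integrable_inv_sqrt_sum_sq_pow hℓ μ hτ).mul_const |μ i|)).mono' (by fun_prop) ?_
  filter_upwards [ae_gaussianVecLaw_ne_zero ℓ μ hτ] with m hm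
  have habs := abs_apply_le_sqrt_sum_sq m i
  have hpos := (abs_pos.2 (hm i)).trans_le habs
  have hsq : ∑ i, m i ^ 2 = √(∑ i, m i ^ 2) ^ 2 := (Real.sq_sqrt (by positivity)).symm
  rw [norm_mul, Real.norm_of_nonneg (by positivity), Real.norm_eq_abs, Pi.add_apply]
  generalize √(∑ i, m i ^ 2) = r at *
  rw [hsq]
  calc (r ^ 2)⁻¹ * |m i - μ i| ≤ (r ^ 2)⁻¹ * (r + |μ i|) := by
        gcongr
        exact (abs_sub _ _).trans (by gcongr)
    _ = r⁻¹ ^ 1 + r⁻¹ ^ 2 * |μ i| := by field_simp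

/-- Fubini for the Gaussian vector, integrating the `i`-th coordinate first. -/
lemma integral_gaussianVecLaw_succAbove {n : ℕ} (μ : Fin (n + 1) → ℝ) (τ : ℝ) (i : Fin (n + 1))
    {F : (Fin (n + 1) → ℝ) → ℝ} (hF : Integrable F (gaussianVecLaw (n + 1) μ τ)) :
    ∫ m, F m ∂gaussianVecLaw (n + 1) μ τ
      = ∫ y, ∫ x, F (i.insertNth x y) ∂gaussianReal (μ i) (τ ^ 2).toNNReal
          ∂gaussianVecLaw n (fun j => μ (i.succAbove j)) τ := by
  have hmp := (measurePreserving_piFinSuccAbove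
    (fun j => gaussianReal (μ j) (τ ^ 2).toNNReal) i).symm
  have hemb := (MeasurableEquiv.piFinSuccAbove (fun _ => ℝ) i).symm.measurableEmbedding
  have hint := (hmp.integrable_comp_emb hemb).2 hF
  rw [gaussianVecLaw, ← hmp.integral_comp hemb]
  exact integral_prod_symm _ hint

lemma integral_inv_sum_sq_mul_sub {ℓ : ℕ} (hℓ : 3 < ℓ) (μ : Fin ℓ → ℝ) {τ : ℝ} (hτ : 0 < τ)
    (i : Fin ℓ) :
    ∫ m, (∑ i, m i ^ 2)⁻¹ * (m i - μ i) ∂gaussianVecLaw ℓ μ τ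
      = -(2 * τ ^ 2) * ∫ m, ((∑ i, m i ^ 2) ^ 2)⁻¹ * m i ∂gaussianVecLaw ℓ μ τ := by
  obtain ⟨n, rfl⟩ : ∃ n, ℓ = n + 1 := ⟨ℓ - 1, by lia⟩
  have hv : (τ ^ 2).toNNReal ≠ 0 := by simpa using hτ.ne'
  rw [integral_gaussianVecLaw_succAbove μ τ i (integrable_inv_sum_sq_mul_sub (by lia) μ hτ i),
    integral_gaussianVecLaw_succAbove μ τ i (integrable_inv_sum_sq_sq_mul hℓ μ hτ i),
    ← integral_const_mul]
  refine integral_congr_ae ?_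
  filter_upwards [ae_gaussianVecLaw_ne_zero n (fun j => μ (i.succAbove j)) hτ] with y hy
  have : Nonempty (Fin n) := ⟨⟨0, by lia⟩⟩
  have hc : 0 < ∑ j, y j ^ 2 :=
    Finset.sum_pos (fun j _ => by have := hy j; positivity) Finset.univ_nonempty
  simpa [Fin.sum_univ_succAbove _ i, Real.coe_toNNReal _ (sq_nonneg τ)] using
    integral_sub_mul_inv_sq_add_gaussianReal (μ i) hv hc

/-- Stein-type identity. Let `ℓ ≥ 4`, `μ ∈ ℝ^ℓ`, `τ > 0`, and `M` a
random vector in `ℝ^ℓ` with independent coordinates `M_i ~ N(μ_i, τ²)`. Then both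
`M/‖M‖⁴` and `(M − μ)/‖M‖²` are integrable (Euclidean norm, `‖m‖² = ∑ m_i²`,
`‖m‖⁴ = (∑ m_i²)²`), and `E[(M − μ)/‖M‖²] = −2τ² E[M/‖M‖⁴]` componentwise. -/
theorem gaussian_stein_identity (ℓ : ℕ) (hℓ : 4 ≤ ℓ)
    (μ : Fin ℓ → ℝ) (τ : ℝ) (hτ : 0 < τ) :
    Integrable (fun m : Fin ℓ → ℝ => ((∑ i, m i ^ 2) ^ 2)⁻¹ • m) (gaussianVecLaw ℓ μ τ) ∧
    Integrable (fun m : Fin ℓ → ℝ => (∑ i, m i ^ 2)⁻¹ • (m - μ)) (gaussianVecLaw ℓ μ τ) ∧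
    (∫ m, (∑ i, m i ^ 2)⁻¹ • (m - μ) ∂(gaussianVecLaw ℓ μ τ))
      = (-(2 * τ ^ 2)) • ∫ m, ((∑ i, m i ^ 2) ^ 2)⁻¹ • m ∂(gaussianVecLaw ℓ μ τ) := by
  have h₁ := integrable_inv_sum_sq_sq_mul hℓ μ hτ
  have h₂ := integrable_inv_sum_sq_mul_sub (Nat.lt_of_succ_lt hℓ) μ hτ
  refine ⟨Integrable.of_eval h₁, Integrable.of_eval h₂, funext fun i => ?_⟩
  refine (eval_integral h₂ i).trans
    (.trans ?_ (congrArg (-(2 * τ ^ 2) * ·) (eval_integral h₁ i).symm))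
  exact integral_inv_sum_sq_mul_sub hℓ μ hτ i
end

section
/- Let ℓ, s ≥ 1 be integers and n = ℓ + s. Let g_β ∈ ℝ, let g_z ∈ ℝ^{ℓ×ℓ} and g_r ∈ ℝ^{s×s} be orthogonal matrices, and let q = blockdiag(g_z, g_r) ∈ ℝ^{n×n}. Let c: ℝ_{≥0} × ℝ_{≥0} → ℝ be any function. For x = (x_z, x_r) ∈ ℝ^ℓ × ℝ^s define b(x) = ((1 − c(‖x_z‖, ‖x_r‖))x_z', x_r')' ∈ ℝ^n and, assuming b(x) ≠ 0, a(x) = I_n − b(x)(b(x)'b(x))^{−1}b(x)'. For y ∈ ℝ^n, assuming x'a(x)x ≠ 0, define d(x, y) = x'a(x)y/(x'a(x)x). Then for all such (x, y): d(qx, q(y + g_β x)) = d(x, y) + g_β. -/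
open Matrix

/-- Euclidean norm of a finite real vector. -/
noncomputable def enorm {ι : Type*} [Fintype ι] (v : ι → ℝ) : ℝ :=
  Real.sqrt (∑ i, v i ^ 2)

/-- The control vector `b(x) = ((1 − c(‖x_z‖, ‖x_r‖)) x_z', x_r')'` for
`x = (x_z, x_r) ∈ ℝ^ℓ × ℝ^s`, where `c` is an arbitrary scalar function of the
two norms. -/
noncomputable def bvec {ℓ s : ℕ} (c : ℝ → ℝ → ℝ) (x : Fin ℓ ⊕ Fin s → ℝ) :
    Fin ℓ ⊕ Fin s → ℝ :=
  Sum.elim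
    ((1 - c (enorm fun i => x (Sum.inl i)) (enorm fun j => x (Sum.inr j))) •
      fun i => x (Sum.inl i))
    (fun j => x (Sum.inr j))

/-- The annihilator matrix `a(x) = I − b(x)(b(x)'b(x))⁻¹b(x)'`. -/
noncomputable def annihCF {ℓ s : ℕ} (c : ℝ → ℝ → ℝ) (x : Fin ℓ ⊕ Fin s → ℝ) :
    Matrix (Fin ℓ ⊕ Fin s) (Fin ℓ ⊕ Fin s) ℝ :=
  1 - (bvec c x ⬝ᵥ bvec c x)⁻¹ • Matrix.vecMulVec (bvec c x) (bvec c x)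

/-- The control-function decision rule `d(x, y) = x'a(x)y / (x'a(x)x)`. -/
noncomputable def cfRule {ℓ s : ℕ} (c : ℝ → ℝ → ℝ) (x y : Fin ℓ ⊕ Fin s → ℝ) : ℝ :=
  (x ⬝ᵥ (annihCF c x).mulVec y) / (x ⬝ᵥ (annihCF c x).mulVec x)

theorem dotProduct_mulVec_mulVec_of_transpose_mul_self {ι : Type*} [Fintype ι] [DecidableEq ι]
    {g : Matrix ι ι ℝ} (hg : gᵀ * g = 1) (u v : ι → ℝ) :
    g.mulVec u ⬝ᵥ g.mulVec v = u ⬝ᵥ v := by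
  rw [Matrix.dotProduct_mulVec, ← Matrix.mulVec_transpose, Matrix.mulVec_mulVec, hg,
    Matrix.one_mulVec]

theorem enorm_mulVec_of_transpose_mul_self {ι : Type*} [Fintype ι] [DecidableEq ι]
    {g : Matrix ι ι ℝ} (hg : gᵀ * g = 1) (v : ι → ℝ) :
    _root_.enorm (g.mulVec v) = _root_.enorm v := by
  have h := dotProduct_mulVec_mulVec_of_transpose_mul_self hg v v
  simp only [dotProduct, ← pow_two] at h
  simp only [_root_.enorm, h]

/-- The control vector is equivariant under block-diagonal orthogonal matrices. -/
theorem bvec_fromBlocks_mulVec {ℓ s : ℕ} {gz : Matrix (Fin ℓ) (Fin ℓ) ℝ}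
    {gr : Matrix (Fin s) (Fin s) ℝ} (hgz : gzᵀ * gz = 1) (hgr : grᵀ * gr = 1)
    (c : ℝ → ℝ → ℝ) (x : Fin ℓ ⊕ Fin s → ℝ) :
    bvec c ((Matrix.fromBlocks gz 0 0 gr).mulVec x) =
      (Matrix.fromBlocks gz 0 0 gr).mulVec (bvec c x) := by
  have hz : (fun i => (Matrix.fromBlocks gz 0 0 gr).mulVec x (Sum.inl i)) =
      gz.mulVec fun i => x (Sum.inl i) := by
    ext i
    simp [Matrix.fromBlocks_mulVec, Function.comp_def]
  have hr : (fun j => (Matrix.fromBlocks gz 0 0 gr).mulVec x (Sum.inr j)) =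
      gr.mulVec fun j => x (Sum.inr j) := by
    ext j
    simp [Matrix.fromBlocks_mulVec, Function.comp_def]
  simp only [bvec, hz, hr, enorm_mulVec_of_transpose_mul_self hgz,
    enorm_mulVec_of_transpose_mul_self hgr]
  rw [← Matrix.mulVec_smul]
  simp only [Matrix.fromBlocks_mulVec, Sum.elim_comp_inl, Sum.elim_comp_inr,
    Matrix.zero_mulVec, add_zero, zero_add]

theorem dotProduct_annihCF_mulVec {ℓ s : ℕ} (c : ℝ → ℝ → ℝ) (x u v : Fin ℓ ⊕ Fin s → ℝ) :
    u ⬝ᵥ (annihCF c x).mulVec v =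
      u ⬝ᵥ v - (bvec c x ⬝ᵥ bvec c x)⁻¹ * ((bvec c x ⬝ᵥ v) * (u ⬝ᵥ bvec c x)) := by
  simp [annihCF, Matrix.sub_mulVec, Matrix.smul_mulVec, Matrix.vecMulVec_mulVec]

/-- invariance of control-function rules. Let `ℓ, s ≥ 1`,
`g_β ∈ ℝ`, `g_z ∈ O(ℓ)`, `g_r ∈ O(s)`, and `q = blockdiag(g_z, g_r)`. For any scalar
function `c` of the two norms, any `x = (x_z, x_r)` with `b(x) ≠ 0` and
`x'a(x)x ≠ 0`, and any `y`:
`d(qx, q(y + g_β x)) = d(x, y) + g_β`. -/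
theorem cfRule_invariant (ℓ s : ℕ) (hℓ : 1 ≤ ℓ) (hs : 1 ≤ s)
    (gβ : ℝ) (gz : Matrix (Fin ℓ) (Fin ℓ) ℝ) (gr : Matrix (Fin s) (Fin s) ℝ)
    (hgz : gzᵀ * gz = 1) (hgr : grᵀ * gr = 1)
    (q : Matrix (Fin ℓ ⊕ Fin s) (Fin ℓ ⊕ Fin s) ℝ)
    (hq : q = Matrix.fromBlocks gz 0 0 gr)
    (c : ℝ → ℝ → ℝ) (x y : Fin ℓ ⊕ Fin s → ℝ)
    (hbx : bvec c x ≠ 0)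
    (hax : x ⬝ᵥ (annihCF c x).mulVec x ≠ 0) :
    cfRule c (q.mulVec x) (q.mulVec (y + gβ • x)) = cfRule c x y + gβ := by
  have hqq : qᵀ * q = 1 := by
    simp [hq, Matrix.fromBlocks_transpose, Matrix.fromBlocks_multiply, hgz, hgr]
  have hb : bvec c (q.mulVec x) = q.mulVec (bvec c x) := by
    rw [hq, bvec_fromBlocks_mulVec hgz hgr]
  have ha (v : Fin ℓ ⊕ Fin s → ℝ) :
      q.mulVec x ⬝ᵥ (annihCF c (q.mulVec x)).mulVec (q.mulVec v) =
        x ⬝ᵥ (annihCF c x).mulVec v := by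
    simp only [dotProduct_annihCF_mulVec, hb,
      dotProduct_mulVec_mulVec_of_transpose_mul_self hqq]
  rw [cfRule, cfRule, ha, ha, Matrix.mulVec_add, Matrix.mulVec_smul, dotProduct_add,
    dotProduct_smul, smul_eq_mul, add_div, mul_div_cancel_right₀ _ hax]
end
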